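/- arXiv:2112.02369 — 3 statements merged into one kernel-verified Lean document; each statement's English description precedes it below -/
import Mathlib

section
/- For every integer n ≥ 3 and every real w ≥ 1, one has v_{12}² − v_{13}² > 0, i.e. the squared first entry of a unit eigenvector for the second-largest eigenvalue of A(w) strictly exceeds the squared first entry of a unit eigenvector for the third-largest eigenvalue of A(w). -/
open Polynomial Real Filter

noncomputable def pathA (n : ℕ) (w : ℝ) : Matrix (Fin n) (Fin n) ℝ :=
  Matrix.of fun i j =>
    if i = j ∧ (i.val = 0 ∨ i.val = n - 1) then w
    else if i.val + 1 = j.val ∨ j.val + 1 = i.val then 1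
    else 0

/-- `μ` lists the eigenvalues of `pathA n w` with multiplicity, in decreasing order
(so `μ ⟨j-1,_⟩` is the `j`-th largest eigenvalue `λ_j(w)`). -/
def IsEigList (n : ℕ) (w : ℝ) (μ : Fin n → ℝ) : Prop :=
  Antitone μ ∧ (pathA n w).charpoly = ∏ i, (Polynomial.X - Polynomial.C (μ i))

/-- The entries of `v`, shifted by one and extended by the boundary values `w * v 0` and
`w * v (Fin.last N)`, so that `pathA` acts as a sum of two neighbours. -/
noncomputable def pathExt {N : ℕ} (w : ℝ) (v : Fin (N + 1) → ℝ) (k : ℕ) : ℝ :=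
  if k = 0 then w * v 0 else if h : k - 1 < N + 1 then v ⟨k - 1, h⟩ else w * v (Fin.last N)

section pathExt

variable {N : ℕ} (w : ℝ) (v : Fin (N + 1) → ℝ)

lemma pathExt_zero : pathExt w v 0 = w * v 0 := by simp [pathExt]

lemma pathExt_succ (i : Fin (N + 1)) : pathExt w v (i + 1) = v i := by
  simp [pathExt, i.isLt]

lemma pathExt_one : pathExt w v 1 = v 0 := pathExt_succ w v 0

lemma pathExt_last : pathExt w v (N + 1) = v (Fin.last N) := pathExt_succ w v (Fin.last N)

lemma pathExt_top : pathExt w v (N + 2) = w * v (Fin.last N) := by simp [pathExt]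

lemma sum_pathExt_sq : ∑ i ∈ Finset.range (N + 1), pathExt w v (i + 1) ^ 2 = ∑ i, v i ^ 2 := by
  rw [Finset.sum_range]
  simp [pathExt_succ]

lemma pathA_mulVec (hN : 1 ≤ N) (i : Fin (N + 1)) :
    (pathA (N + 1) w).mulVec v i = pathExt w v i + pathExt w v (i + 2) := by
  have h : ∀ j : Fin (N + 1), pathA (N + 1) w i j * v j =
      ((if j.val + 1 = i.val then v j else 0) + (if i.val = 0 then if j = i then w * v j else 0
        else 0)) + ((if j.val = i.val + 1 then v j else 0) +
        (if i.val = N then if j = i then w * v j else 0 else 0)) := by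
    intro j
    simp only [pathA, Matrix.of_apply, Fin.ext_iff, Nat.add_sub_cancel]
    split_ifs <;> first | omega | ring
  simp only [Matrix.mulVec, dotProduct]
  rw [Finset.sum_congr rfl fun j _ => h j, Finset.sum_add_distrib, Finset.sum_add_distrib,
    Finset.sum_add_distrib]
  congr 1
  · by_cases hi : i.val = 0
    · have : i = 0 := Fin.ext hi
      subst this
      simp [pathExt_zero]
    · rw [Finset.sum_eq_single (⟨i.val - 1, by omega⟩ : Fin (N + 1))]
      · have h1 : i.val - 1 + 1 = i.val := by omega
        have h2 : i.val - 1 < N + 1 := by omega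
        simp [hi, h1, pathExt, h2]
      · intro j _ hj
        rw [if_neg]
        intro h'
        exact hj (Fin.ext (by simp; omega))
      · simp
  · by_cases hi : i.val = N
    · have : i = Fin.last N := Fin.ext hi
      subst this
      rw [Finset.sum_eq_zero]
      · simp [pathExt_top]
      · intro j _
        rw [if_neg]
        simp
        omega
    · rw [Finset.sum_eq_single (⟨i.val + 1, by omega⟩ : Fin (N + 1))]
      · have h2 : i.val + 1 < N + 1 := by omega
        simp [hi, pathExt, h2]
      · intro j _ hj
        rw [if_neg]
        intro h'
        exact hj (Fin.ext (by simpa using h'))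
      · simp

end pathExt

lemma sum_mul_second_difference (X : ℕ → ℝ) (N : ℕ) :
    ∑ i ∈ Finset.range (N + 1), X (i + 1) * (2 * X (i + 1) - X i - X (i + 2)) =
      ∑ i ∈ Finset.range N, (X (i + 2) - X (i + 1)) ^ 2 + X 1 * (X 1 - X 0)
        + X (N + 1) * (X (N + 1) - X (N + 2)) := by
  induction N with
  | zero => simp; ring
  | succ N ih => rw [Finset.sum_range_succ, ih, Finset.sum_range_succ]; ring

lemma eq_zero_of_recurrence {X : ℕ → ℝ} {l : ℝ} {N : ℕ}
    (hX : ∀ j < N, X j + X (j + 2) = l * X (j + 1)) (h0 : X 0 = 0) (h1 : X 1 = 0) :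
    ∀ k ≤ N, X k = 0 ∧ X (k + 1) = 0 := by
  intro k
  induction k with
  | zero => exact fun _ => ⟨h0, h1⟩
  | succ k ih =>
    intro hk
    obtain ⟨ha, hb⟩ := ih (by omega)
    refine ⟨hb, ?_⟩
    have := hX k (by omega)
    rw [ha, hb] at this
    simpa using this

lemma recurrence_invariant {X : ℕ → ℝ} {l : ℝ} {N : ℕ}
    (hX : ∀ j < N, X j + X (j + 2) = l * X (j + 1)) :
    ∀ k ≤ N, X k ^ 2 + X (k + 1) ^ 2 - l * X k * X (k + 1) =
      X 0 ^ 2 + X 1 ^ 2 - l * X 0 * X 1 := by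
  intro k
  induction k with
  | zero => simp
  | succ k ih =>
    intro hk
    have h := hX k (by omega)
    rw [← ih (by omega), ← sub_eq_zero]
    linear_combination (X (k + 2) - X k) * h

lemma recurrence_sum_sq {X : ℕ → ℝ} {l : ℝ} {N : ℕ}
    (hX : ∀ j < N, X j + X (j + 2) = l * X (j + 1)) :
    ∀ k ≤ N, (4 - l ^ 2) * ∑ i ∈ Finset.range k, X (i + 1) ^ 2 =
      2 * (k + 1) * (X 0 ^ 2 + X 1 ^ 2 - l * X 0 * X 1) - 2 * X 0 ^ 2 - 2 * X (k + 1) ^ 2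
        + l * X 0 * X 1 + l * X k * X (k + 1) := by
  intro k
  induction k with
  | zero => intro _; simp; ring
  | succ k ih =>
    intro hk
    have h := hX k (by omega)
    have hE := recurrence_invariant hX (k + 1) hk
    rw [Finset.sum_range_succ, mul_add, ih (by omega)]
    push_cast
    linear_combination 2 * hE + l * X (k + 1) * h

lemma sq_sub_le_mul_sum_sq (X : ℕ → ℝ) (N : ℕ) :
    (X (N + 1) - X 1) ^ 2 ≤ N * ∑ i ∈ Finset.range N, (X (i + 2) - X (i + 1)) ^ 2 := by
  have h := sq_sum_le_card_mul_sum_sq (s := Finset.range N) (f := fun i => X (i + 2) - X (i + 1))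
  rw [Finset.sum_range_sub (fun i => X (i + 1)) N] at h
  simpa using h

section eigenvectors

variable {N : ℕ} {w l : ℝ} {v : Fin (N + 1) → ℝ}

lemma pathExt_recurrence (hN : 1 ≤ N) (hv : (pathA (N + 1) w).mulVec v = l • v) :
    ∀ j < N + 1, pathExt w v j + pathExt w v (j + 2) = l * pathExt w v (j + 1) := by
  intro j hj
  have h := congrFun hv ⟨j, hj⟩
  rw [pathA_mulVec w v hN] at h
  simpa [← pathExt_succ w v] using h

lemma eigenvector_eq_zero (hN : 1 ≤ N) (hv : (pathA (N + 1) w).mulVec v = l • v)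
    (h0 : v 0 = 0) : v = 0 := by
  have h := eq_zero_of_recurrence (pathExt_recurrence hN hv)
    (by rw [pathExt_zero, h0, mul_zero]) (by rw [pathExt_one, h0])
  funext i
  have := (h i (by omega)).2
  rwa [pathExt_succ] at this

lemma pathA_mulVec_rev (hv : (pathA (N + 1) w).mulVec v = l • v) :
    (pathA (N + 1) w).mulVec (fun i => v i.rev) = l • (fun i => v i.rev) := by
  funext i
  have h := congrFun hv i.rev
  simp only [Matrix.mulVec, dotProduct, Pi.smul_apply] at h ⊢
  rw [← h]
  refine Fintype.sum_equiv Fin.revPerm _ _ fun j => ?_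
  congr 1
  simp only [pathA, Matrix.of_apply, Fin.revPerm_apply, Fin.ext_iff, Fin.val_rev]
  congr 1
  · apply propext; omega
  · congr 1; apply propext; omega

lemma eigenvector_last_sq (hN : 1 ≤ N) (hv : (pathA (N + 1) w).mulVec v = l • v) :
    v (Fin.last N) ^ 2 = v 0 ^ 2 := by
  have h : (pathA (N + 1) w).mulVec (v 0 • (fun i => v i.rev) - v (Fin.last N) • v) =
      l • (v 0 • (fun i => v i.rev) - v (Fin.last N) • v) := by
    rw [Matrix.mulVec_sub, Matrix.mulVec_smul, Matrix.mulVec_smul, hv, pathA_mulVec_rev hv,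
      smul_sub, smul_comm l, smul_comm l]
  have h' := congrFun (eigenvector_eq_zero hN h (by simp; ring)) (Fin.last N)
  simp at h'
  linarith

lemma eigenvector_first_sq (hN : 1 ≤ N) (hv : (pathA (N + 1) w).mulVec v = l • v)
    (hunit : ∑ i, v i ^ 2 = 1) :
    4 - l ^ 2 = 2 * v 0 ^ 2 * ((N + 1) * (1 + w ^ 2 - w * l) + 1 - w ^ 2) := by
  have h := recurrence_sum_sq (pathExt_recurrence hN hv) (N + 1) le_rfl
  rw [sum_pathExt_sq, hunit, pathExt_top, pathExt_last, pathExt_zero, pathExt_one] at h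
  have h' := eigenvector_last_sq hN hv
  push_cast at h
  linear_combination h + (-2 * w ^ 2 + l * w) * h'

lemma eigenvector_first_ne_zero (hN : 1 ≤ N) (hv : (pathA (N + 1) w).mulVec v = l • v)
    (hunit : ∑ i, v i ^ 2 = 1) : v 0 ≠ 0 := by
  intro h
  rw [eigenvector_eq_zero hN hv h] at hunit
  simp at hunit

end eigenvectors

section quadraticForm

variable {N : ℕ} (w : ℝ) (x : Fin (N + 1) → ℝ)

lemma pathA_quadraticForm (hN : 1 ≤ N) :
    2 * (x ⬝ᵥ x) - x ⬝ᵥ (pathA (N + 1) w).mulVec x =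
      ∑ i ∈ Finset.range N, (pathExt w x (i + 2) - pathExt w x (i + 1)) ^ 2
        - (w - 1) * (x 0 ^ 2 + x (Fin.last N) ^ 2) := by
  have h := sum_mul_second_difference (pathExt w x) N
  rw [Finset.sum_range, pathExt_top, pathExt_last, pathExt_zero, pathExt_one] at h
  simp only [pathExt_succ] at h
  have h2 : 2 * (x ⬝ᵥ x) - x ⬝ᵥ (pathA (N + 1) w).mulVec x =
      ∑ i : Fin (N + 1), x i * (2 * x i - pathExt w x i - pathExt w x (i + 2)) := by
    simp only [dotProduct, Finset.mul_sum, ← Finset.sum_sub_distrib, pathA_mulVec w x hN]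
    exact Finset.sum_congr rfl fun i _ => by ring
  rw [h2, h]
  ring

/-- A vector on which the quadratic form of `pathA` is at least `2`, and whose end entries are
opposite, vanishes unless the loops are heavy. -/
lemma eq_zero_of_two_mul_le (hN : 1 ≤ N)
    (hx : 2 * (x ⬝ᵥ x) ≤ x ⬝ᵥ (pathA (N + 1) w).mulVec x) (hend : x (Fin.last N) = -x 0)
    (h : (w - 1) * N < 2 ∨ x 0 = 0) : x = 0 := by
  have hN' : (0 : ℝ) < N := by exact_mod_cast hN
  have hq := pathA_quadraticForm w x hN
  set S := ∑ i ∈ Finset.range N, (pathExt w x (i + 2) - pathExt w x (i + 1)) ^ 2 with hS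
  have hcs := sq_sub_le_mul_sum_sq (pathExt w x) N
  rw [← hS, pathExt_last, pathExt_one, hend] at hcs
  rw [hend] at hq
  have hSle : S ≤ (w - 1) * (2 * x 0 ^ 2) := by nlinarith
  have h0 : x 0 = 0 := by
    rcases h with h | h
    · by_contra hne
      have hpos : 0 < x 0 ^ 2 := by positivity
      have h1 : (N : ℝ) * S ≤ N * ((w - 1) * (2 * x 0 ^ 2)) :=
        mul_le_mul_of_nonneg_left hSle hN'.le
      have h2 := mul_lt_mul_of_pos_right h hpos
      nlinarith
    · exact h
  have hS0 : S = 0 := le_antisymm (by simpa [h0] using hSle)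
    (Finset.sum_nonneg fun i _ => sq_nonneg _)
  rw [hS, Finset.sum_eq_zero_iff_of_nonneg fun i _ => sq_nonneg _] at hS0
  have hall : ∀ k ≤ N, pathExt w x (k + 1) = 0 := by
    intro k
    induction k with
    | zero => intro _; rw [pathExt_one, h0]
    | succ k ih =>
      intro hk
      have := hS0 k (Finset.mem_range.2 (by omega))
      rw [ih (by omega)] at this
      simpa using this
  funext i
  have := hall i (by omega)
  rwa [pathExt_succ] at this

end quadraticForm

lemma pathA_isHermitian (n : ℕ) (w : ℝ) : (pathA n w).IsHermitian := by
  ext i j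
  simp only [pathA, Matrix.conjTranspose_apply, Matrix.of_apply, star_trivial]
  congr 1
  · apply propext
    constructor <;> (rintro ⟨rfl, h⟩; exact ⟨rfl, h⟩)
  · congr 1
    apply propext
    omega

lemma Matrix.IsHermitian.exists_orthonormal_eigenvectors {n : ℕ} {A : Matrix (Fin n) (Fin n) ℝ}
    (hA : A.IsHermitian) {μ : Fin n → ℝ}
    (hμ : A.charpoly = ∏ i, (Polynomial.X - Polynomial.C (μ i))) :
    ∃ b : Fin n → Fin n → ℝ, (∀ i, A.mulVec (b i) = μ i • b i) ∧
      (∀ i j, b i ⬝ᵥ b j = if i = j then 1 else 0) ∧ ∀ x, x = ∑ i, (b i ⬝ᵥ x) • b i := by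
  have hms : Finset.univ.val.map hA.eigenvalues = Finset.univ.val.map μ := by
    have h := hA.charpoly_eq
    rw [hμ] at h
    have h' := congrArg Polynomial.roots h
    simp only [RCLike.ofReal_real_eq_id, id] at h'
    have key : ∀ f : Fin n → ℝ, (∏ i, (Polynomial.X - Polynomial.C (f i))).roots
        = Finset.univ.val.map f := fun f => by
      rw [← Polynomial.roots_multiset_prod_X_sub_C (Finset.univ.val.map f), Multiset.map_map]
      rfl
    rw [key, key] at h'
    exact h'.symm
  obtain ⟨σ, hσ⟩ : ∃ σ : Equiv.Perm (Fin n), ∀ i, hA.eigenvalues (σ i) = μ i := by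
    simp only [Fin.univ_val_map, Multiset.coe_eq_coe] at hms
    have h := List.Perm.eq_of_pairwise'
      (Tuple.monotone_sort hA.eigenvalues).sortedLE_ofFn.pairwise
      (Tuple.monotone_sort μ).sortedLE_ofFn.pairwise
      ((((Tuple.sort hA.eigenvalues).ofFn_comp_perm _).trans hms).trans
        ((Tuple.sort μ).ofFn_comp_perm μ).symm)
    refine ⟨(Tuple.sort μ).symm.trans (Tuple.sort hA.eigenvalues), fun i => ?_⟩
    have h' := congrFun (List.ofFn_injective h) ((Tuple.sort μ).symm i)
    simpa using h'
  refine ⟨fun i => (hA.eigenvectorBasis (σ i)).ofLp, fun i => ?_, fun i j => ?_, fun x => ?_⟩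
  · rw [hA.mulVec_eigenvectorBasis, hσ]
  · have h := orthonormal_iff_ite.1 hA.eigenvectorBasis.orthonormal (σ i) (σ j)
    rw [EuclideanSpace.inner_eq_star_dotProduct] at h
    simp at h
    rw [dotProduct_comm]
    exact h
  · have h := (hA.eigenvectorBasis.reindex σ.symm).sum_repr' (WithLp.toLp 2 x)
    have h' := congrArg WithLp.ofLp h
    simp [EuclideanSpace.inner_eq_star_dotProduct, WithLp.ofLp_sum] at h'
    conv_lhs => rw [← h']
    exact Finset.sum_congr rfl fun i _ => by rw [dotProduct_comm]

lemma sum_smul_dotProduct_sum_smul {ι κ : Type*} [Fintype ι] [DecidableEq ι] [Fintype κ]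
    {b : ι → κ → ℝ} (hb : ∀ i j, b i ⬝ᵥ b j = if i = j then 1 else 0) (c d : ι → ℝ) :
    (∑ i, c i • b i) ⬝ᵥ (∑ i, d i • b i) = ∑ i, c i * d i := by
  simp [sum_dotProduct, dotProduct_sum, hb, mul_comm]

lemma mulVec_sum_smul_eigenvectors {ι κ : Type*} [Fintype ι] [Fintype κ]
    {A : Matrix κ κ ℝ} {b : ι → κ → ℝ} {l : ι → ℝ} (hA : ∀ i, A.mulVec (b i) = l i • b i)
    (c : ι → ℝ) : A.mulVec (∑ i, c i • b i) = ∑ i, (c i * l i) • b i := by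
  simp [Matrix.mulVec_sum, Matrix.mulVec_smul, hA, mul_smul]

/-- A nonzero combination of orthonormal eigenvectors of `pathA` with eigenvalues at least `2`
cannot have opposite end entries, unless the loops are heavy. -/
lemma false_of_two_le_eigenvalues {ι : Type*} [Fintype ι] [DecidableEq ι] {N : ℕ} {w : ℝ}
    (hN : 1 ≤ N) {b : ι → Fin (N + 1) → ℝ} {l : ι → ℝ}
    (hA : ∀ i, (pathA (N + 1) w).mulVec (b i) = l i • b i)
    (hb : ∀ i j, b i ⬝ᵥ b j = if i = j then 1 else 0) (hl : ∀ i, 2 ≤ l i)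
    {c : ι → ℝ} (hc : c ≠ 0) (hend : ∑ i, c i * b i (Fin.last N) = -∑ i, c i * b i 0)
    (h : (w - 1) * N < 2 ∨ ∑ i, c i * b i 0 = 0) : False := by
  have hx := eq_zero_of_two_mul_le w (∑ i, c i • b i) hN
    (by
      rw [mulVec_sum_smul_eigenvectors hA, sum_smul_dotProduct_sum_smul hb,
        sum_smul_dotProduct_sum_smul hb, Finset.mul_sum]
      exact Finset.sum_le_sum fun i _ => by nlinarith [hl i, mul_self_nonneg (c i)])
    (by simpa using hend) (by simpa using h)
  have h0 := sum_smul_dotProduct_sum_smul hb c c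
  rw [hx, zero_dotProduct, eq_comm,
    Finset.sum_eq_zero_iff_of_nonneg fun i _ => mul_self_nonneg (c i)] at h0
  exact hc (funext fun i => mul_self_eq_zero.1 (h0 i (Finset.mem_univ i)))

lemma exists_orthogonal_pair (r s : ℝ) : ∃ α β : ℝ, α * r + β * s = 0 ∧ (α ≠ 0 ∨ β ≠ 0) := by
  by_cases hr : r = 0
  · exact ⟨1, 0, by simp [hr], by simp⟩
  · exact ⟨-s, r, by ring, Or.inr hr⟩

lemma eigenvalue_injective {ι : Type*} [DecidableEq ι] {N : ℕ} {w : ℝ}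
    (hN : 1 ≤ N) {b : ι → Fin (N + 1) → ℝ} {l : ι → ℝ}
    (hA : ∀ i, (pathA (N + 1) w).mulVec (b i) = l i • b i)
    (hb : ∀ i j, b i ⬝ᵥ b j = if i = j then 1 else 0) : Function.Injective l := by
  intro i j hij
  by_contra hne
  have hz := eigenvector_eq_zero (v := b i 0 • b j - b j 0 • b i) (l := l i) hN
    (by rw [Matrix.mulVec_sub, Matrix.mulVec_smul, Matrix.mulVec_smul, hA, hA, ← hij, smul_sub,
      smul_comm (l i), smul_comm (l i)]) (by simp; ring)
  have h1 := congrArg (b i ⬝ᵥ ·) hz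
  simp [hb, hne] at h1
  have h2 := hb j j
  rw [eigenvector_eq_zero hN (hA j) h1] at h2
  simp at h2

lemma third_eigenvalue_lt_two {N : ℕ} {w : ℝ} (hN : 1 ≤ N) {b : Fin 3 → Fin (N + 1) → ℝ}
    {l : Fin 3 → ℝ} (hA : ∀ i, (pathA (N + 1) w).mulVec (b i) = l i • b i)
    (hb : ∀ i j, b i ⬝ᵥ b j = if i = j then 1 else 0) (hl : Antitone l) : l 2 < 2 := by
  by_contra! h
  obtain ⟨c, hc, hc'⟩ := Matrix.exists_mulVec_eq_zero_iff.2
    (show (!![b 0 0, b 1 0, b 2 0; b 0 (Fin.last N), b 1 (Fin.last N), b 2 (Fin.last N);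
      0, 0, 0]).det = 0 by simp [Matrix.det_fin_three])
  have h1 := congrFun hc' 0
  have h2 := congrFun hc' 1
  simp [Matrix.mulVec, dotProduct, Fin.sum_univ_three] at h1 h2
  have h1' : ∑ i, c i * b i 0 = 0 := by rw [Fin.sum_univ_three]; linarith
  refine false_of_two_le_eigenvalues hN hA hb
    (fun i => h.trans (hl (Fin.le_last i))) hc ?_ (Or.inr h1')
  rw [h1', Fin.sum_univ_three]
  linarith

lemma second_eigenvalue_lt_two {N : ℕ} {w : ℝ} (hN : 1 ≤ N) {b : Fin 2 → Fin (N + 1) → ℝ}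
    {l : Fin 2 → ℝ} (hA : ∀ i, (pathA (N + 1) w).mulVec (b i) = l i • b i)
    (hb : ∀ i j, b i ⬝ᵥ b j = if i = j then 1 else 0) (hl : Antitone l)
    (hw : (w - 1) * N < 2) : l 1 < 2 := by
  by_contra! h
  obtain ⟨α, β, h0, hne⟩ := exists_orthogonal_pair (b 0 0 + b 0 (Fin.last N))
    (b 1 0 + b 1 (Fin.last N))
  refine false_of_two_le_eigenvalues hN hA hb (fun i => h.trans (hl (Fin.le_last i)))
    (c := ![α, β]) (fun hc => ?_) ?_ (Or.inl hw)
  · have h1 := congrFun hc 0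
    have h2 := congrFun hc 1
    simp at h1 h2
    tauto
  · simp [Fin.sum_univ_two]
    linarith

/-- With heavy loops, the quadratic form of `pathA` is at least `2` on the plane of arithmetic
progressions. -/
lemma two_mul_le_arithmetic {N : ℕ} {w : ℝ} (hN : 1 ≤ N) (hw : 2 ≤ (w - 1) * N) (α β : ℝ) :
    let x : Fin (N + 1) → ℝ := fun i => α + β * (2 * i - N)
    2 * (x ⬝ᵥ x) ≤ x ⬝ᵥ (pathA (N + 1) w).mulVec x := by
  intro x
  have hq := pathA_quadraticForm w x hN
  have hsum : ∑ i ∈ Finset.range N, (pathExt w x (i + 2) - pathExt w x (i + 1)) ^ 2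
      = N * (2 * β) ^ 2 := by
    rw [Finset.sum_congr rfl (g := fun _ => (2 * β) ^ 2)]
    · simp
    · intro i hi
      have hi' := Finset.mem_range.1 hi
      have h1 := pathExt_succ w x ⟨i, by omega⟩
      have h2 := pathExt_succ w x ⟨i + 1, by omega⟩
      simp only at h1 h2
      rw [h1, h2]
      simp only [x]
      push_cast
      ring
  rw [hsum] at hq
  simp only [x, Fin.val_zero, Fin.val_last, Nat.cast_zero] at hq
  have hN' : (1 : ℝ) ≤ N := by exact_mod_cast hN
  have hw1 : 0 ≤ w - 1 := by
    by_contra! hneg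
    nlinarith
  have h1 : 0 ≤ (w - 1) * α ^ 2 := by positivity
  have h2 : 0 ≤ ((w - 1) * N - 2) * (N * β ^ 2) :=
    mul_nonneg (by linarith) (by positivity)
  nlinarith

lemma two_le_second_eigenvalue {N : ℕ} {w : ℝ} (hN : 1 ≤ N) (hw : 2 ≤ (w - 1) * N)
    {b : Fin (N + 1) → Fin (N + 1) → ℝ} {l : Fin (N + 1) → ℝ}
    (hA : ∀ i, (pathA (N + 1) w).mulVec (b i) = l i • b i)
    (hb : ∀ i j, b i ⬝ᵥ b j = if i = j then 1 else 0)
    (hspan : ∀ x, x = ∑ i, (b i ⬝ᵥ x) • b i) (hl : Antitone l) : 2 ≤ l ⟨1, by omega⟩ := by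
  obtain ⟨α, β, h0, hne⟩ := exists_orthogonal_pair (b 0 ⬝ᵥ fun _ => 1)
    (b 0 ⬝ᵥ fun i => 2 * (i : ℝ) - N)
  have hle := two_mul_le_arithmetic hN hw α β
  set x : Fin (N + 1) → ℝ := fun i => α + β * (2 * i - N) with hx
  have hx0 : b 0 ⬝ᵥ x = 0 := by
    rw [← h0]
    simp only [dotProduct, hx, Finset.mul_sum, ← Finset.sum_add_distrib]
    exact Finset.sum_congr rfl fun i _ => by ring
  have hxx : 0 < x ⬝ᵥ x := by
    refine lt_of_le_of_ne (Finset.sum_nonneg fun i _ => mul_self_nonneg _) fun h => ?_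
    have hz := dotProduct_self_eq_zero.1 h.symm
    have h1 := congrFun hz 0
    have h2 := congrFun hz (Fin.last N)
    simp [hx] at h1 h2
    have hN' : (N : ℝ) ≠ 0 := by exact_mod_cast (by omega : N ≠ 0)
    have hα : α = 0 := by linarith
    have hβ : β * N = 0 := by linarith
    rcases hne with h | h
    · exact h hα
    · exact mul_ne_zero h hN' hβ
  have hform : x ⬝ᵥ (pathA (N + 1) w).mulVec x = ∑ i, (b i ⬝ᵥ x) * ((b i ⬝ᵥ x) * l i) := by
    conv_lhs => rw [hspan x, mulVec_sum_smul_eigenvectors hA, sum_smul_dotProduct_sum_smul hb]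
  have hnorm : x ⬝ᵥ x = ∑ i, (b i ⬝ᵥ x) * (b i ⬝ᵥ x) := by
    conv_lhs => rw [hspan x, sum_smul_dotProduct_sum_smul hb]
  have hupper : x ⬝ᵥ (pathA (N + 1) w).mulVec x ≤ l ⟨1, by omega⟩ * (x ⬝ᵥ x) := by
    rw [hform, hnorm, Finset.mul_sum]
    refine Finset.sum_le_sum fun i _ => ?_
    by_cases hi : i = 0
    · simp [hi, hx0]
    · have hpos : 1 ≤ i.val := Nat.one_le_iff_ne_zero.2 fun h => hi (Fin.ext h)
      have := hl (show (⟨1, by omega⟩ : Fin (N + 1)) ≤ i from hpos)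
      nlinarith [mul_self_nonneg (b i ⬝ᵥ x)]
  exact le_of_mul_le_mul_right (hle.trans hupper) hxx

lemma sum_sq_arithmetic (N : ℕ) :
    3 * ∑ i ∈ Finset.range (N + 1), (2 * (i : ℝ) - N) ^ 2 = (N : ℝ) * (N + 1) * (N + 2) := by
  have h : ∀ (M : ℕ) (a : ℝ), 3 * ∑ i ∈ Finset.range M, (2 * (i : ℝ) - a) ^ 2 =
      M * (2 * (M - 1) * (2 * M - 1) - 6 * a * (M - 1) + 3 * a ^ 2) := by
    intro M a
    induction M with
    | zero => simp
    | succ M ih => rw [Finset.sum_range_succ, mul_add, ih]; push_cast; ring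
  rw [h]
  push_cast
  ring

/-- At the critical loop weight the eigenvector for the eigenvalue `2` is an arithmetic
progression. -/
lemma first_sq_of_eigenvalue_two {N : ℕ} {w : ℝ} (hN : 1 ≤ N) (hw : (w - 1) * N = 2)
    {v : Fin (N + 1) → ℝ} (hv : (pathA (N + 1) w).mulVec v = (2 : ℝ) • v)
    (hunit : ∑ i, v i ^ 2 = 1) : (N + 1) * w * v 0 ^ 2 = 3 := by
  have hrec := pathExt_recurrence hN hv
  have hlin : ∀ k ≤ N + 1, pathExt w v k * N = v 0 * (N + 2 - 2 * k) ∧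
      pathExt w v (k + 1) * N = v 0 * (N - 2 * k) := by
    intro k
    induction k with
    | zero =>
      intro _
      rw [pathExt_zero, pathExt_one]
      push_cast
      exact ⟨by linear_combination v 0 * hw, by ring⟩
    | succ k ih =>
      intro hk
      obtain ⟨h1, h2⟩ := ih (by omega)
      have h3 := hrec k (by omega)
      push_cast
      exact ⟨by linear_combination h2, by linear_combination N * h3 + 2 * h2 - h1⟩
  have hsum : (N : ℝ) ^ 2 = v 0 ^ 2 * ∑ i ∈ Finset.range (N + 1), (2 * (i : ℝ) - N) ^ 2 := by
    rw [← mul_one ((N : ℝ) ^ 2), ← hunit, ← sum_pathExt_sq w v, Finset.mul_sum, Finset.mul_sum]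
    refine Finset.sum_congr rfl fun i hi => ?_
    have h := (hlin i (Finset.mem_range.1 hi).le).2
    rw [← mul_pow, mul_comm, h]
    ring
  have h3 := sum_sq_arithmetic N
  have hN' : (N : ℝ) ≠ 0 := by exact_mod_cast (by omega : N ≠ 0)
  have h4 : (N : ℝ) * ((N + 1) * (N + 2) * v 0 ^ 2) = N * (3 * N) := by
    linear_combination (-v 0 ^ 2) * h3 - 3 * hsum
  have h5 := mul_left_cancel₀ hN' h4
  refine mul_left_cancel₀ hN' ?_
  linear_combination h5 + (N + 1) * v 0 ^ 2 * hw

lemma lt_of_gap_relations {N w l2 l3 y2 y3 : ℝ} (hN : 1 ≤ N) (hw : 1 ≤ w) (h32 : l3 < l2)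
    (h3 : l3 < 2) (e2 : 4 - l2 ^ 2 = 2 * y2 * ((N + 1) * (1 + w ^ 2 - w * l2) + 1 - w ^ 2))
    (e3 : 4 - l3 ^ 2 = 2 * y3 * ((N + 1) * (1 + w ^ 2 - w * l3) + 1 - w ^ 2)) (p2 : 0 < y2)
    (h2 : (w - 1) * N < 2 → l2 < 2) (h2' : 2 ≤ (w - 1) * N → 2 ≤ l2)
    (hcrit : (w - 1) * N = 2 → l2 = 2 → (N + 1) * w * y2 = 3) : y3 < y2 := by
  have hK : 0 < (N + 1) * w := by positivity
  obtain ⟨a, ha⟩ : ∃ a, (N + 1) * w * a = (N + 1) * (1 + w ^ 2) + 1 - w ^ 2 :=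
    ⟨((N + 1) * (1 + w ^ 2) + 1 - w ^ 2) / ((N + 1) * w), by field_simp⟩
  have ha2 : (N + 1) * w * (a - 2) = (w - 1) * ((w - 1) * N - 2) := by
    linear_combination ha
  have ha0 : 0 < a := by
    have : 0 < (N + 1) * w * a := by rw [ha]; nlinarith [sq_nonneg w]
    exact pos_of_mul_pos_right this hK.le
  set K := (N + 1) * w
  have f2 : 4 - l2 ^ 2 = 2 * (K * y2) * (a - l2) := by linear_combination e2 - 2 * y2 * ha
  have f3 : 4 - l3 ^ 2 = 2 * (K * y3) * (a - l3) := by linear_combination e3 - 2 * y3 * ha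
  have q2 : 0 < K * y2 := by positivity
  refine lt_of_mul_lt_mul_left (a := K) ?_ hK.le
  generalize K * y2 = u2 at *
  generalize K * y3 = u3 at *
  rcases lt_or_ge ((w - 1) * N) 2 with hlt | hge
  · have hl2 := h2 hlt
    have hale : a ≤ 2 := by
      have : K * (a - 2) ≤ 0 := by rw [ha2]; nlinarith
      by_contra! h
      nlinarith
    have hl2a : l2 < a := by
      by_contra! h
      nlinarith [mul_nonneg q2.le (sub_nonneg.2 h)]
    have hprod : 0 < (a - l2) * (a - l3) := mul_pos (by linarith) (by linarith)
    have key : 0 < (l2 - l3) * ((a - l2) * (a - l3) + (4 - a ^ 2)) :=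
      mul_pos (by linarith) (by nlinarith)
    have : 0 < (u2 - u3) * (2 * ((a - l2) * (a - l3))) := by
      calc 0 < _ := key
        _ = _ := by linear_combination (a - l3) * f2 - (a - l2) * f3
    linarith [pos_of_mul_pos_left this (by positivity)]
  · have hl2 := h2' hge
    have hage : 2 ≤ a := by
      have : 0 ≤ K * (a - 2) := by rw [ha2]; exact mul_nonneg (by linarith) (by linarith)
      by_contra! h
      nlinarith
    have hu3 : u3 < 2 := by
      by_contra! h
      nlinarith [mul_nonneg (sub_nonneg.2 h) (show 0 ≤ a - l3 by linarith),
        mul_self_pos.2 (show l3 - 2 ≠ 0 by linarith)]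
    have hu2 : 2 < u2 := by
      rcases hge.eq_or_lt with heq | hgt
      · have haeq : a = 2 := by
          rw [← heq, sub_self, mul_zero] at ha2
          linarith [(mul_eq_zero.1 ha2).resolve_left hK.ne']
        rcases hl2.eq_or_lt with h | h
        · linarith [hcrit heq.symm h.symm]
        · subst haeq
          have : (l2 - 2) * (2 * u2 - (l2 + 2)) = 0 := by linear_combination f2
          linarith [(mul_eq_zero.1 this).resolve_left (by linarith)]
      · have hw1 : 0 < w - 1 := by
          by_contra! h
          nlinarith
        have hagt : 2 < a := by
          have : 0 < K * (a - 2) := by rw [ha2]; exact mul_pos hw1 (by linarith)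
          linarith [pos_of_mul_pos_right this hK.le]
        by_contra! h
        have hal2 : a ≤ l2 := by
          by_contra! h'
          nlinarith [mul_pos q2 (sub_pos.2 h')]
        nlinarith [mul_nonneg (sub_nonneg.2 h) (sub_nonneg.2 hal2), sq_nonneg (l2 - 2)]
    linarith

/-- For `n ≥ 3` and `w ≥ 1`, `v₁₂² − v₁₃² > 0`: the squared first entry of a unit
eigenvector for the second-largest eigenvalue strictly exceeds that for the
third-largest eigenvalue. -/
theorem gap23 (n : ℕ) (hn : 3 ≤ n) (w : ℝ) (hw : 1 ≤ w)
    (μ : Fin n → ℝ) (hμ : IsEigList n w μ)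
    (v2 v3 : Fin n → ℝ)
    (hv2unit : ∑ i, v2 i ^ 2 = 1)
    (hv2 : (pathA n w).mulVec v2 = μ ⟨1, by omega⟩ • v2)
    (hv3unit : ∑ i, v3 i ^ 2 = 1)
    (hv3 : (pathA n w).mulVec v3 = μ ⟨2, by omega⟩ • v3) :
    0 < v2 ⟨0, by omega⟩ ^ 2 - v3 ⟨0, by omega⟩ ^ 2 := by
  obtain ⟨N, rfl⟩ : ∃ N, n = N + 1 := ⟨n - 1, by omega⟩
  obtain ⟨hanti, hchar⟩ := hμ
  obtain ⟨b, hA, hb, hspan⟩ :=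
    (pathA_isHermitian (N + 1) w).exists_orthonormal_eigenvectors hchar
  have hN : 1 ≤ N := by omega
  have hN' : (1 : ℝ) ≤ N := by exact_mod_cast hN
  have h32 : μ ⟨2, by omega⟩ < μ ⟨1, by omega⟩ :=
    lt_of_le_of_ne (hanti (by simp)) fun h => by
      simpa using eigenvalue_injective hN hA hb h
  have h3 : μ ⟨2, by omega⟩ < 2 :=
    third_eigenvalue_lt_two hN (b := fun i => b (Fin.castLE hn i))
      (l := fun i => μ (Fin.castLE hn i)) (fun i => hA _) (fun i j => by simp [hb])
      (fun i j h => hanti h)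
  have e2 := eigenvector_first_sq hN hv2 hv2unit
  have e3 := eigenvector_first_sq hN hv3 hv3unit
  have z2 := eigenvector_first_ne_zero hN hv2 hv2unit
  have h2 : (w - 1) * N < 2 → μ ⟨1, by omega⟩ < 2 := fun h =>
    second_eigenvalue_lt_two hN (b := fun i => b (Fin.castLE (by omega) i))
      (l := fun i => μ (Fin.castLE (by omega) i)) (fun i => hA _) (fun i j => by simp [hb])
      (fun i j h => hanti h) h
  have h2' : 2 ≤ (w - 1) * N → 2 ≤ μ ⟨1, by omega⟩ := fun h =>
    two_le_second_eigenvalue hN h hA hb hspan hanti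
  have hcrit : (w - 1) * N = 2 → μ ⟨1, by omega⟩ = 2 → (N + 1) * w * v2 0 ^ 2 = 3 :=
    fun h h' => first_sq_of_eigenvalue_two hN h (by rw [hv2, h']) hv2unit
  change 0 < v2 0 ^ 2 - v3 0 ^ 2
  change _ = 2 * v3 0 ^ 2 * _ at e3
  generalize μ ⟨1, by omega⟩ = l2 at *
  generalize μ ⟨2, by omega⟩ = l3 at *
  have p2 : 0 < v2 0 ^ 2 := by positivity
  generalize v2 0 ^ 2 = y2 at *
  generalize v3 0 ^ 2 = y3 at *
  exact sub_pos.2 (lt_of_gap_relations hN' hw h32 h3 e2 e3 p2 h2 h2' hcrit)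
end

section
/- Let n ≥ 3, let w ∈ ℝ, and let λ be an eigenvalue of A(w). Define a₁ = λ − w and a_k = λ − 1/a_{k−1} for 2 ≤ k ≤ n − 1, and assume a_k ≠ 0 for 1 ≤ k ≤ n − 2 (so the recursion is well defined). Define v ∈ ℝⁿ by v₁ = 1 and v_k = a_{k−1} v_{k−1} for 2 ≤ k ≤ n. Then v is an eigenvector of A(w) with eigenvalue λ, i.e. A(w) v = λ v. -/
open Polynomial Real Filter

theorem pathA_mulVec_first {n : ℕ} (hn : 2 ≤ n) (w : ℝ) (x : Fin n → ℝ) :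
    (pathA n w).mulVec x ⟨0, by omega⟩ = w * x ⟨0, by omega⟩ + x ⟨1, by omega⟩ := by
  rw [Matrix.mulVec, dotProduct,
    Fintype.sum_eq_add (⟨0, by omega⟩ : Fin n) ⟨1, by omega⟩ (by simp)]
  · simp [pathA]
  · rintro ⟨j, hj⟩ ⟨h0, h1⟩
    simp only [ne_eq, Fin.mk.injEq] at h0 h1
    have h : ¬ 0 = j := by omega
    have h' : ¬ 1 = j := by omega
    simp [pathA, h, h']

theorem pathA_mulVec_inner {n : ℕ} (w : ℝ) (x : Fin n → ℝ) (k : ℕ) (hk : k + 2 < n) :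
    (pathA n w).mulVec x ⟨k + 1, by omega⟩ = x ⟨k, by omega⟩ + x ⟨k + 2, hk⟩ := by
  rw [Matrix.mulVec, dotProduct,
    Fintype.sum_eq_add (⟨k, by omega⟩ : Fin n) ⟨k + 2, hk⟩ (by simp)]
  · simp [pathA]
  · rintro ⟨j, hj⟩ ⟨h0, h1⟩
    simp only [ne_eq, Fin.mk.injEq] at h0 h1
    have h : ¬ k + 1 = n - 1 := by omega
    have h' : ¬ k + 1 + 1 = j := by omega
    have h'' : ¬ j = k := by omega
    simp [pathA, h, h', h'']

/-- A `lam`-eigenvector of `pathA n w` is determined by its first entry: it is a multiple of any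
vector that starts with `1` and obeys the three-term recurrence of the rows before the last. -/
theorem eq_smul_of_pathA_mulVec_eq_smul {n : ℕ} (hn : 2 ≤ n) {w lam : ℝ} {u v : Fin n → ℝ}
    (hu : (pathA n w).mulVec u = lam • u)
    (hv0 : v ⟨0, by omega⟩ = 1) (hv1 : v ⟨1, by omega⟩ = lam - w)
    (hv : ∀ (k : ℕ) (hk : k + 2 < n),
      v ⟨k + 2, hk⟩ = lam * v ⟨k + 1, by omega⟩ - v ⟨k, by omega⟩) :
    u = u ⟨0, by omega⟩ • v := by
  suffices h : ∀ (k : ℕ) (hk : k < n), u ⟨k, hk⟩ = u ⟨0, by omega⟩ * v ⟨k, hk⟩ from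
    funext fun i => h i i.isLt
  intro k
  induction k using Nat.twoStepInduction with
  | zero => simp [hv0]
  | one =>
    intro hk
    have h := congrFun hu ⟨0, by omega⟩
    rw [pathA_mulVec_first hn, Pi.smul_apply, smul_eq_mul] at h
    rw [hv1]
    linarith
  | more k ih ih' =>
    intro hk
    have h := congrFun hu ⟨k + 1, by omega⟩
    rw [pathA_mulVec_inner w u k hk, Pi.smul_apply, smul_eq_mul, ih (by omega),
      ih' (by omega)] at h
    rw [hv k hk]
    linarith

/-- If `λ` is an eigenvalue of `A(w)` and `v` is built by the recursion
`v₁ = 1`, `v_k = a_{k-1} v_{k-1}` with `a₁ = λ − w`, `a_k = λ − 1/a_{k−1}`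
(all in 1-indexed notation; here 0-indexed), then `v` is a `λ`-eigenvector. -/
theorem evec_recur (n : ℕ) (hn : 3 ≤ n) (w lam : ℝ)
    (hlam : lam ∈ spectrum ℝ (pathA n w))
    (a : ℕ → ℝ)
    (ha1 : a 1 = lam - w)
    (harec : ∀ k : ℕ, 2 ≤ k → k ≤ n - 1 → a k = lam - 1 / a (k - 1))
    (hane : ∀ k : ℕ, 1 ≤ k → k ≤ n - 2 → a k ≠ 0)
    (v : Fin n → ℝ)
    (hv1 : v ⟨0, by omega⟩ = 1)
    (hvrec : ∀ (k : ℕ) (hk1 : 1 ≤ k) (hkn : k < n),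
      v ⟨k, hkn⟩ = a k * v ⟨k - 1, by omega⟩) :
    (pathA n w).mulVec v = lam • v := by
  have hv2 : v ⟨1, by omega⟩ = lam - w := by
    rw [hvrec 1 le_rfl (by omega), ha1]
    simp [hv1]
  have hv : ∀ (k : ℕ) (hk : k + 2 < n),
      v ⟨k + 2, hk⟩ = lam * v ⟨k + 1, by omega⟩ - v ⟨k, by omega⟩ := by
    intro k hk
    have h1 := hvrec (k + 1) (by omega) (by omega)
    have h2 := hvrec (k + 2) (by omega) hk
    have h3 := harec (k + 2) (by omega) (by omega)
    have h4 := hane (k + 1) (by omega) (by omega)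
    simp only [Nat.add_sub_cancel, show k + 2 - 1 = k + 1 by omega] at h1 h2 h3
    rw [h2, h3, h1]
    field_simp
  rw [← Matrix.spectrum_toLin', ← Module.End.hasEigenvalue_iff_mem_spectrum] at hlam
  obtain ⟨u, hu⟩ := hlam.exists_hasEigenvector
  have hAu : (pathA n w).mulVec u = lam • u := by
    simpa using hu.apply_eq_smul
  have huv := eq_smul_of_pathA_mulVec_eq_smul (by omega) hAu hv1 hv2 hv
  have hu0 : u ⟨0, by omega⟩ ≠ 0 := fun h => hu.2 (by rw [huv, h, zero_smul])
  rw [huv, Matrix.mulVec_smul, smul_comm lam] at hAu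
  exact smul_right_injective _ hu0 (by simpa [hv1] using hAu)
end

section
/- Let n ≥ 4 be even and let w > 1. Then λ₁(w), the largest eigenvalue of A(w), equals the largest eigenvalue of B₁(w), and λ₂(w), the second-largest eigenvalue of A(w), equals the largest eigenvalue of B₂(w). -/
open Polynomial Real Filter

/-- The `m × m` symmetric tridiagonal matrix with diagonal `(w, 0, …, 0, 1)` and all
sub/superdiagonal entries `1`. -/
noncomputable def B1mat (m : ℕ) (w : ℝ) : Matrix (Fin m) (Fin m) ℝ :=
  Matrix.of fun i j =>
    if i = j then (if i.val = 0 then w else if i.val = m - 1 then 1 else 0)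
    else if i.val + 1 = j.val ∨ j.val + 1 = i.val then 1
    else 0

/-- The `m × m` symmetric tridiagonal matrix with diagonal `(w, 0, …, 0, −1)` and all
sub/superdiagonal entries `1`. -/
noncomputable def B2mat (m : ℕ) (w : ℝ) : Matrix (Fin m) (Fin m) ℝ :=
  Matrix.of fun i j =>
    if i = j then (if i.val = 0 then w else if i.val = m - 1 then -1 else 0)
    else if i.val + 1 = j.val ∨ j.val + 1 = i.val then 1
    else 0

open Matrix in
/-- A block matrix `[[P, E], [E, P]]` has the spectrum of `P + E` together with that of `P - E`. -/
theorem charpoly_fromBlocks_symm {ι R : Type*} [Fintype ι] [DecidableEq ι] [CommRing R]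
    (P E : Matrix ι ι R) :
    (fromBlocks P E E P).charpoly = (P + E).charpoly * (P - E).charpoly := by
  have h : fromBlocks P E E P =
      fromBlocks 1 (-1) 0 1 * (fromBlocks (P + E) 0 E (P - E) * fromBlocks 1 1 0 1) := by
    simp [fromBlocks_multiply]
  rw [h, charpoly_mul_comm, Matrix.mul_assoc]
  simp [fromBlocks_multiply, charpoly_fromBlocks_zero₁₂]

open Matrix in
/-- The Rayleigh quotient of a real symmetric matrix is at most any upper bound of its
eigenvalues. -/
theorem Matrix.IsHermitian.dotProduct_mulVec_le {ι : Type*} [Fintype ι] [DecidableEq ι]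
    {B : Matrix ι ι ℝ} (hB : B.IsHermitian) {c : ℝ} (hc : ∀ i, hB.eigenvalues i ≤ c)
    (x : ι → ℝ) : x ⬝ᵥ B *ᵥ x ≤ c * (x ⬝ᵥ x) := by
  have hH : (algebraMap ℝ (Matrix ι ι ℝ) c - B).IsHermitian := by
    refine IsHermitian.sub ?_ hB
    rw [algebraMap_eq_diagonal]
    exact isHermitian_diagonal _
  have hP : (algebraMap ℝ (Matrix ι ι ℝ) c - B).PosSemidef := by
    refine posSemidef_iff_isHermitian_and_spectrum_nonneg.2 ⟨hH, ?_⟩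
    rw [← spectrum.singleton_sub_eq, hB.spectrum_real_eq_range_eigenvalues]
    rintro _ ⟨_, rfl, _, ⟨i, rfl⟩, rfl⟩
    exact sub_nonneg.2 (hc i)
  have := hP.dotProduct_mulVec_nonneg x
  simp only [sub_mulVec, dotProduct_sub, Algebra.algebraMap_eq_smul_one, smul_mulVec, one_mulVec,
    dotProduct_smul, star_trivial, smul_eq_mul] at this
  linarith

open Matrix in
/-- The unit eigenvectors of a real symmetric matrix are orthonormal for the dot product. -/
theorem Matrix.IsHermitian.dotProduct_eigenvectorBasis {ι : Type*} [Fintype ι] [DecidableEq ι]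
    {B : Matrix ι ι ℝ} (hB : B.IsHermitian) (i j : ι) :
    (hB.eigenvectorBasis i).ofLp ⬝ᵥ (hB.eigenvectorBasis j).ofLp = if i = j then 1 else 0 := by
  have := orthonormal_iff_ite.1 hB.eigenvectorBasis.orthonormal i j
  rw [← this, EuclideanSpace.inner_eq_star_dotProduct, star_trivial, dotProduct_comm]

open Matrix in
/-- If the quadratic form of `B` is dominated by that of `C`, every eigenvalue of `B` is at most
any upper bound of the eigenvalues of `C`. -/
theorem Matrix.IsHermitian.eigenvalues_le_of_le {ι : Type*} [Fintype ι] [DecidableEq ι]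
    {B C : Matrix ι ι ℝ} (hB : B.IsHermitian) (hC : C.IsHermitian)
    (hBC : ∀ x : ι → ℝ, x ⬝ᵥ B *ᵥ x ≤ x ⬝ᵥ C *ᵥ x) {c : ℝ} (hc : ∀ i, hC.eigenvalues i ≤ c)
    (i : ι) : hB.eigenvalues i ≤ c := by
  have h := (hBC (hB.eigenvectorBasis i).ofLp).trans (hC.dotProduct_mulVec_le hc _)
  simpa [hB.mulVec_eigenvectorBasis, hB.dotProduct_eigenvectorBasis] using h

open Matrix in
/-- If the quadratic forms of `B` and `C` agree on the hyperplane `x k = 0`, then of any two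
eigenvalues of `B` the smaller one is at most any upper bound of the eigenvalues of `C`. -/
theorem Matrix.IsHermitian.eigenvalues_le_of_eq_on_hyperplane {ι : Type*} [Fintype ι]
    [DecidableEq ι] {B C : Matrix ι ι ℝ} (hB : B.IsHermitian) (hC : C.IsHermitian) (k : ι)
    (hBC : ∀ x : ι → ℝ, x k = 0 → x ⬝ᵥ B *ᵥ x = x ⬝ᵥ C *ᵥ x) {c : ℝ}
    (hc : ∀ i, hC.eigenvalues i ≤ c) {i j : ι} (hij : i ≠ j)
    (hle : hB.eigenvalues i ≤ hB.eigenvalues j) : hB.eigenvalues i ≤ c := by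
  obtain ⟨s, t, hst, hk⟩ : ∃ s t : ℝ, 0 < s ^ 2 + t ^ 2 ∧
      s * hB.eigenvectorBasis i k + t * hB.eigenvectorBasis j k = 0 := by
    by_cases h : hB.eigenvectorBasis i k = 0
    · exact ⟨1, 0, by norm_num, by simp [h]⟩
    · exact ⟨-hB.eigenvectorBasis j k, hB.eigenvectorBasis i k, by positivity, by ring⟩
  set u := (hB.eigenvectorBasis i).ofLp
  set v := (hB.eigenvectorBasis j).ofLp
  have huu : u ⬝ᵥ u = 1 := by simp [u, hB.dotProduct_eigenvectorBasis]
  have hvv : v ⬝ᵥ v = 1 := by simp [v, hB.dotProduct_eigenvectorBasis]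
  have huv : u ⬝ᵥ v = 0 := by simp [u, v, hB.dotProduct_eigenvectorBasis, hij]
  have hvu : v ⬝ᵥ u = 0 := by rw [dotProduct_comm, huv]
  have hBu : B *ᵥ u = hB.eigenvalues i • u := hB.mulVec_eigenvectorBasis i
  have hBv : B *ᵥ v = hB.eigenvalues j • v := hB.mulVec_eigenvectorBasis j
  have h := hC.dotProduct_mulVec_le hc (s • u + t • v)
  rw [← hBC _ (by simpa using hk)] at h
  simp only [mulVec_add, mulVec_smul, hBu, hBv, dotProduct_add, add_dotProduct, dotProduct_smul,
    smul_dotProduct, smul_eq_mul, huu, hvv, huv, hvu] at h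
  nlinarith [mul_le_mul_of_nonneg_left hle (sq_nonneg t)]

/-- The top two entries of a decreasing list whose underlying multiset is the union of two
families `b` and `c` with `c ≤ b i₀` and `b i ≤ c j₀` for `i ≠ i₀`. -/
theorem Antitone.top_two_eq_of_map_eq_add {M : ℕ} (hM : 2 ≤ M) {ι κ α : Type*} [Fintype ι] [Fintype κ]
    [DecidableEq ι] [LinearOrder α] {μ : Fin M → α} (hμ : Antitone μ) {b : ι → α} {c : κ → α}
    (h : Finset.univ.val.map μ = Finset.univ.val.map b + Finset.univ.val.map c)
    {i₀ : ι} {j₀ : κ} (hi₀ : ∀ i, b i ≤ b i₀) (hj₀ : ∀ j, c j ≤ c j₀) (hcb : c j₀ ≤ b i₀)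
    (hbc : ∀ i, i ≠ i₀ → b i ≤ c j₀) :
    μ ⟨0, by omega⟩ = b i₀ ∧ μ ⟨1, by omega⟩ = c j₀ := by
  obtain ⟨N, rfl⟩ := Nat.exists_eq_add_of_le' hM
  change μ 0 = b i₀ ∧ μ 1 = c j₀
  have hmem (x : α) : x ∈ Finset.univ.val.map μ ↔ (∃ i, b i = x) ∨ ∃ j, c j = x := by simp [h]
  have h0 : μ 0 = b i₀ := by
    apply le_antisymm
    · obtain ⟨i, hi⟩ | ⟨j, hj⟩ := (hmem (μ 0)).1 (by simp)
      · exact hi ▸ hi₀ i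
      · exact hj ▸ (hj₀ j).trans hcb
    · have := (hmem (b i₀)).2 (Or.inl ⟨i₀, rfl⟩)
      simp only [Multiset.mem_map] at this
      obtain ⟨k, -, hk⟩ := this
      exact hk ▸ hμ (Fin.zero_le k)
  refine ⟨h0, ?_⟩
  rw [← Finset.insert_erase (Finset.mem_univ (0 : Fin (N + 2))),
    ← Finset.insert_erase (Finset.mem_univ i₀),
    Finset.insert_val_of_notMem (Finset.notMem_erase _ _),
    Finset.insert_val_of_notMem (Finset.notMem_erase _ _), Multiset.map_cons, Multiset.map_cons, h0,
    Multiset.cons_add, Multiset.cons_inj_right] at h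
  have hmem' (x : α) : (∃ k, k ≠ 0 ∧ μ k = x) ↔ (∃ i, i ≠ i₀ ∧ b i = x) ∨ ∃ j, c j = x := by
    have : x ∈ (Finset.univ.erase (0 : Fin (N + 2))).val.map μ ↔
      x ∈ (Finset.univ.erase i₀).val.map b + Finset.univ.val.map c := by rw [h]
    rw [Multiset.mem_add, Multiset.mem_map, Multiset.mem_map, Multiset.mem_map] at this
    simpa only [Finset.mem_val, Finset.mem_erase, Finset.mem_univ, and_true, true_and] using this
  apply le_antisymm
  · obtain ⟨i, hi, hb⟩ | ⟨j, hj⟩ := (hmem' (μ 1)).1 ⟨1, by simp, rfl⟩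
    · exact hb ▸ hbc i hi
    · exact hj ▸ hj₀ j
  · obtain ⟨k, hk, hc⟩ := (hmem' (c j₀)).2 (Or.inr ⟨j₀, rfl⟩)
    exact hc ▸ hμ (Fin.one_le_of_ne_zero hk)

theorem B1mat_isHermitian (m : ℕ) (w : ℝ) : (B1mat m w).IsHermitian := by
  ext i j
  by_cases h : i = j
  · subst h; simp
  · simp [B1mat, h, Ne.symm h, or_comm]

theorem B2mat_isHermitian (m : ℕ) (w : ℝ) : (B2mat m w).IsHermitian := by
  ext i j
  by_cases h : i = j
  · subst h; simp
  · simp [B2mat, h, Ne.symm h, or_comm]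

/-- `B₁` and `B₂` differ by `2` in the last diagonal entry. -/
theorem B1mat_eq_B2mat_add (m : ℕ) (w : ℝ) (k : Fin m) (hk : k.val = m - 1) (hk0 : k.val ≠ 0) :
    B1mat m w = B2mat m w + 2 • Matrix.single k k 1 := by
  ext i j
  simp only [B1mat, B2mat, Matrix.of_apply, Matrix.add_apply, Matrix.smul_apply,
    Matrix.single_apply, Fin.ext_iff]
  split_ifs <;> first | omega | norm_num

open Matrix in
theorem dotProduct_B1mat_mulVec (m : ℕ) (w : ℝ) (k : Fin m) (hk : k.val = m - 1)
    (hk0 : k.val ≠ 0) (x : Fin m → ℝ) :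
    x ⬝ᵥ B1mat m w *ᵥ x = x ⬝ᵥ B2mat m w *ᵥ x + 2 * x k ^ 2 := by
  rw [B1mat_eq_B2mat_add m w k hk hk0, add_mulVec, dotProduct_add, smul_mulVec, single_mulVec]
  simp [Function.update_apply, dotProduct]
  ring

/-- Splitting into symmetric and antisymmetric vectors under reversal of the path. -/
theorem pathA_charpoly (m : ℕ) (hm : 2 ≤ m) (w : ℝ) :
    (pathA (m + m) w).charpoly = (B1mat m w).charpoly * (B2mat m w).charpoly := by
  let e : Fin m ⊕ Fin m ≃ Fin (m + m) :=
    (Equiv.sumCongr (Equiv.refl _) Fin.revPerm).trans finSumFinEquiv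
  let k : Fin m := ⟨m - 1, by omega⟩
  have hB := B1mat_eq_B2mat_add m w k rfl (by simp [k]; omega)
  have h1 : B1mat m w = (B1mat m w - Matrix.single k k 1) + Matrix.single k k 1 := by abel
  have h2 : B2mat m w = (B1mat m w - Matrix.single k k 1) - Matrix.single k k 1 := by
    rw [hB]; abel
  have hA : Matrix.reindex e.symm e.symm (pathA (m + m) w) =
      Matrix.fromBlocks (B1mat m w - Matrix.single k k 1) (Matrix.single k k 1)
        (Matrix.single k k 1) (B1mat m w - Matrix.single k k 1) := by
    ext (i | i) (j | j) <;>
    · have := i.isLt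
      have := j.isLt
      simp only [e, k, pathA, B1mat, Matrix.single_apply, Matrix.reindex_apply, Equiv.symm_symm,
        Matrix.submatrix_apply, Equiv.trans_apply, Equiv.sumCongr_apply, Sum.map_inl, Sum.map_inr,
        Equiv.refl_apply, Fin.revPerm_apply, finSumFinEquiv_apply_left,
        finSumFinEquiv_apply_right, Matrix.of_apply, Matrix.sub_apply, Matrix.fromBlocks_apply₁₁,
        Matrix.fromBlocks_apply₁₂, Matrix.fromBlocks_apply₂₁, Matrix.fromBlocks_apply₂₂,
        Fin.ext_iff, Fin.val_castAdd, Fin.val_natAdd, Fin.val_rev]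
      split_ifs <;> first | omega | norm_num
  rw [← Matrix.charpoly_reindex e.symm, hA, charpoly_fromBlocks_symm, ← h1, ← h2]

/-- For even `n ≥ 4` and `w > 1`, the largest eigenvalue of `A(w)` is the largest
eigenvalue of `B₁(w)`, and the second-largest eigenvalue of `A(w)` is the largest
eigenvalue of `B₂(w)`. -/
theorem lambda12_eq_B1B2_top (n : ℕ) (hn : 4 ≤ n) (hne : Even n) (w : ℝ) (hw : 1 < w)
    (μ : Fin n → ℝ) (hμ : IsEigList n w μ) :
    IsGreatest (spectrum ℝ (B1mat (n / 2) w)) (μ ⟨0, by omega⟩) ∧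
    IsGreatest (spectrum ℝ (B2mat (n / 2) w)) (μ ⟨1, by omega⟩) := by
  obtain ⟨m, rfl⟩ := hne
  obtain ⟨hanti, hchar⟩ := hμ
  rw [show (m + m) / 2 = m by omega]
  have hm : 2 ≤ m := by omega
  have : Nonempty (Fin m) := ⟨⟨0, by omega⟩⟩
  have hB₁ := B1mat_isHermitian m w
  have hB₂ := B2mat_isHermitian m w
  let k : Fin m := ⟨m - 1, by omega⟩
  have hquad := dotProduct_B1mat_mulVec m w k rfl (by simp [k]; omega)
  have hroots : Finset.univ.val.map μ =
      Finset.univ.val.map hB₁.eigenvalues + Finset.univ.val.map hB₂.eigenvalues := by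
    have h := congrArg Polynomial.roots (hchar.symm.trans (pathA_charpoly m hm w))
    rw [Polynomial.roots_mul
      (mul_ne_zero (Matrix.charpoly_monic _).ne_zero (Matrix.charpoly_monic _).ne_zero),
      hB₁.roots_charpoly_eq_eigenvalues, hB₂.roots_charpoly_eq_eigenvalues, Finset.prod,
      show (fun i => X - C (μ i)) = (fun a => X - C a) ∘ μ from rfl, ← Multiset.map_map,
      Polynomial.roots_multiset_prod_X_sub_C] at h
    simpa using h
  obtain ⟨i₀, hi₀⟩ := Finite.exists_max hB₁.eigenvalues
  obtain ⟨j₀, hj₀⟩ := Finite.exists_max hB₂.eigenvalues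
  have hcb := hB₂.eigenvalues_le_of_le hB₁
    (fun x => by rw [hquad]; linarith [sq_nonneg (x k)]) hi₀ j₀
  have hbc (i) (hi : i ≠ i₀) : hB₁.eigenvalues i ≤ hB₂.eigenvalues j₀ :=
    hB₁.eigenvalues_le_of_eq_on_hyperplane hB₂ k (fun x hx => by simp [hquad, hx]) hj₀ hi (hi₀ i)
  rw [hB₁.spectrum_real_eq_range_eigenvalues, hB₂.spectrum_real_eq_range_eigenvalues]
  have htop := hanti.top_two_eq_of_map_eq_add (by omega) hroots hi₀ hj₀ hcb hbc
  rw [htop.1, htop.2]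
  exact ⟨⟨⟨i₀, rfl⟩, by rintro _ ⟨i, rfl⟩; exact hi₀ i⟩,
    ⟨⟨j₀, rfl⟩, by rintro _ ⟨j, rfl⟩; exact hj₀ j⟩⟩
end
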